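/- arXiv:2212.00610 — 2 statements merged into one kernel-verified Lean document; each statement's English description precedes it below -/
import Mathlib

section
/- Fix positive integers t, k, n and let 𝒞 be a set of positive integers, each at least t. Suppose n can be written as an integer linear combination of elements of 𝒞 with nonnegative coefficients, and suppose: (1) for each ℓ ∈ 𝒞 there exists a t-tone k-coloring φ_ℓ of C_ℓ (with vertices labeled 1,...,ℓ in cyclic order); and (2) for each ordered pair (ℓ₁, ℓ₂) ∈ 𝒞 × 𝒞 (allowing ℓ₁ = ℓ₂), coloring the cycle C_{2t} by assigning its first t vertices the labels that φ_{ℓ₁} gives to vertices ℓ₁−t+1, ..., ℓ₁ of C_{ℓ₁} and assigning its last t vertices the labels that φ_{ℓ₂} gives to vertices 1, ..., t of C_{ℓ₂} yields a t-tone k-coloring of C_{2t}. Then τ_t(C_n) ≤ k. -/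
open SimpleGraph

/-- A `t`-tone `k`-coloring of a graph `G` assigns to each vertex a `t`-element subset of
`{1, …, k}` so that the labels of any two distinct vertices `v, w` share fewer than
`d(v,w)` colors (no constraint between different components, where the distance is infinite). -/
def IsTToneColoring {V : Type*} (G : SimpleGraph V) (t k : ℕ) (f : V → Finset ℕ) : Prop :=
  (∀ v, f v ⊆ Finset.Icc 1 k) ∧ (∀ v, (f v).card = t) ∧
    ∀ ⦃v w : V⦄, v ≠ w → ((f v ∩ f w).card : ℕ∞) < G.edist v w

/-- The `t`-tone chromatic number: the least `k` admitting a `t`-tone `k`-coloring. -/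
noncomputable def toneChromaticNumber {V : Type*} (G : SimpleGraph V) (t : ℕ) : ℕ :=
  sInf {k | ∃ f : V → Finset ℕ, IsTToneColoring G t k f}

/-- In a cycle graph the distance is at most the distance along the underlying path. -/
theorem cycleGraph_edist_le_sub {m : ℕ} (d : ℕ) : ∀ i j : Fin m, j.val = i.val + d →
    (cycleGraph m).edist i j ≤ d := by
  induction d with
  | zero =>
    intro i j h
    obtain rfl : i = j := Fin.ext (by omega)
    simp
  | succ d ih =>
    intro i j h
    have hj := j.isLt
    let x : Fin m := ⟨i.val + d, by omega⟩
    have hadj : (cycleGraph m).Adj x j :=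
      pathGraph_le_cycleGraph (pathGraph_adj.2 (Or.inl (by simp only [x]; omega)))
    calc (cycleGraph m).edist i j
        ≤ (cycleGraph m).edist i x + (cycleGraph m).edist x j := SimpleGraph.edist_triangle
      _ ≤ d + 1 := add_le_add (ih i x rfl) (edist_eq_one_iff_adj.2 hadj).le
      _ = ((d + 1 : ℕ) : ℕ∞) := by push_cast; rfl

/-- A walk in a cycle graph displaces its start by an integer of absolute value at most its
length. -/
theorem cycleGraph_walk_displacement {m : ℕ} {v w : Fin m} (p : (cycleGraph m).Walk v w) :
    ∃ z : ℤ, |z| ≤ p.length ∧ (m : ℤ) ∣ (w : ℤ) - v - z := by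
  induction p with
  | nil => exact ⟨0, by simp⟩
  | @cons u v w h p ih =>
    obtain ⟨z, hz, hdvd⟩ := ih
    have hstep : ∃ e : ℤ, |e| ≤ 1 ∧ (m : ℤ) ∣ (v : ℤ) - u - e := by
      have key : ∀ a b : Fin m, (a - b).val = 1 → (m : ℤ) ∣ (a : ℤ) - b - 1 := by
        intro a b hab
        rw [Fin.val_sub] at hab
        have ha := a.isLt
        have hb := b.isLt
        rcases lt_or_ge (m - b.val + a.val) m with hlt | hge
        · rw [Nat.mod_eq_of_lt hlt] at hab
          exact ⟨-1, by omega⟩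
        · rw [Nat.mod_eq_sub_mod hge, Nat.mod_eq_of_lt (by omega)] at hab
          exact ⟨0, by omega⟩
      rcases cycleGraph_adj'.1 h with h | h
      · refine ⟨-1, by simp, ?_⟩
        obtain ⟨r, hr⟩ := key _ _ h
        exact ⟨-r, by linarith⟩
      · exact ⟨1, by simp, key _ _ h⟩
    obtain ⟨e, he, hdvd'⟩ := hstep
    refine ⟨z + e, (abs_add_le z e).trans ?_, ?_⟩
    · rw [Walk.length_cons]
      push_cast
      linarith
    · obtain ⟨a, ha⟩ := hdvd
      obtain ⟨b, hb⟩ := hdvd'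
      exact ⟨a + b, by linarith⟩

/-- The two ends of a walk in a cycle graph are joined by an arc that is at most as long as
the walk. -/
theorem cycleGraph_exists_arc {m : ℕ} {v w : Fin m} (hvw : v ≠ w)
    (p : (cycleGraph m).Walk v w) :
    ∃ s : ℕ, 0 < s ∧ s < m ∧ s ≤ p.length ∧
      (w.val = (v.val + s) % m ∨ v.val = (w.val + s) % m) := by
  obtain ⟨z, hz, hdvd⟩ := cycleGraph_walk_displacement p
  have key : ∀ a b : Fin m, a ≠ b → ∀ q : ℕ, (m : ℤ) ∣ (b : ℤ) - a - q →
      0 < q % m ∧ b.val = (a.val + q % m) % m := by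
    intro a b hab q hq
    have hb : b.val = (a.val + q % m) % m := by
      rw [Nat.add_mod_mod]
      have : a.val + q ≡ b.val [MOD m] := by
        rw [← Int.natCast_modEq_iff]
        refine (Int.modEq_iff_dvd).2 ?_
        rwa [Nat.cast_add, ← sub_sub]
      rw [this, Nat.mod_eq_of_lt b.isLt]
    refine ⟨Nat.pos_of_ne_zero fun h0 => hab (Fin.ext ?_), hb⟩
    rw [hb, h0, Nat.add_zero, Nat.mod_eq_of_lt a.isLt]
  have hm : 0 < m := v.pos
  have hle : z.natAbs % m ≤ p.length := by
    rw [Int.abs_eq_natAbs] at hz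
    exact (Nat.mod_le _ _).trans (by exact_mod_cast hz)
  rcases le_total 0 z with h | h
  · have hk := key v w hvw z.natAbs (by rwa [Int.natAbs_of_nonneg h])
    exact ⟨_, hk.1, Nat.mod_lt _ hm, hle, Or.inl hk.2⟩
  · have hk := key w v hvw.symm z.natAbs (by
      obtain ⟨r, hr⟩ := hdvd
      rw [Int.ofNat_natAbs_of_nonpos h]
      exact ⟨-r, by linarith⟩)
    exact ⟨_, hk.1, Nat.mod_lt _ hm, hle, Or.inr hk.2⟩

/-- The concatenation of the blocks `φ ℓ 0, …, φ ℓ (ℓ - 1)`, for `ℓ` running through a list. -/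
def blockWord (φ : ℕ → ℕ → Finset ℕ) : List ℕ → ℕ → Finset ℕ
  | [], _ => ∅
  | ℓ :: L, i => if i < ℓ then φ ℓ i else blockWord φ L (i - ℓ)

theorem blockWord_append (φ : ℕ → ℕ → Finset ℕ) (L M : List ℕ) (i : ℕ) :
    blockWord φ (L ++ M) i = if i < L.sum then blockWord φ L i else blockWord φ M (i - L.sum) := by
  induction L generalizing i with
  | nil => simp
  | cons ℓ L ih =>
    simp only [List.cons_append, blockWord, ih, List.sum_cons]
    split_ifs <;> first | rfl | omega | (congr 1; omega)

theorem exists_block_eq_blockWord (φ : ℕ → ℕ → Finset ℕ) (L : List ℕ) {i : ℕ} (hi : i < L.sum) :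
    ∃ ℓ ∈ L, ∃ j < ℓ, blockWord φ L i = φ ℓ j := by
  induction L generalizing i with
  | nil => simp at hi
  | cons ℓ L ih =>
    rw [List.sum_cons] at hi
    by_cases h : i < ℓ
    · exact ⟨ℓ, by simp, i, h, by simp [blockWord, h]⟩
    · obtain ⟨ℓ', hℓ', j, hj, he⟩ := ih (i := i - ℓ) (by omega)
      exact ⟨ℓ', by simp [hℓ'], j, hj, by simp [blockWord, h, he]⟩

/-- Nearby labels of a concatenation satisfy the tone condition along the path. -/
theorem card_blockWord_inter_lt {t k : ℕ} {𝒞 : Finset ℕ} (h𝒞 : ∀ ℓ ∈ 𝒞, t ≤ ℓ)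
    {φ : ℕ → ℕ → Finset ℕ}
    (h1 : ∀ ℓ ∈ 𝒞, IsTToneColoring (cycleGraph ℓ) t k (fun i : Fin ℓ => φ ℓ i.val))
    (h2 : ∀ ℓ₁ ∈ 𝒞, ∀ ℓ₂ ∈ 𝒞, IsTToneColoring (cycleGraph (2 * t)) t k
      (fun i : Fin (2 * t) =>
        if i.val < t then φ ℓ₁ (ℓ₁ - t + i.val) else φ ℓ₂ (i.val - t)))
    (L : List ℕ) (hL : ∀ ℓ ∈ L, ℓ ∈ 𝒞) (i s : ℕ) (hs : 0 < s) (hst : s ≤ t)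
    (his : i + s < L.sum) :
    (blockWord φ L i ∩ blockWord φ L (i + s)).card < s := by
  induction L generalizing i with
  | nil => simp at his
  | cons ℓ L ih =>
    rw [List.sum_cons] at his
    have hℓ : ℓ ∈ 𝒞 := hL ℓ (by simp)
    have hL' : ∀ x ∈ L, x ∈ 𝒞 := fun x hx => hL x (by simp [hx])
    simp only [blockWord]
    by_cases hi : i < ℓ
    · by_cases hj : i + s < ℓ
      · rw [if_pos hi, if_pos hj]
        have := ((h1 ℓ hℓ).2.2 (v := ⟨i, hi⟩) (w := ⟨i + s, hj⟩)
          (by simp [Fin.ext_iff]; omega)).trans_le (cycleGraph_edist_le_sub s _ _ rfl)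
        exact_mod_cast this
      · rw [if_pos hi, if_neg hj]
        cases L with
        | nil => simp at his; omega
        | cons ℓ' L =>
          have hℓ' : ℓ' ∈ 𝒞 := hL' ℓ' (by simp)
          have htℓ := h𝒞 ℓ hℓ
          have htℓ' := h𝒞 ℓ' hℓ'
          have hj' : i + s - ℓ < ℓ' := by omega
          simp only [blockWord, if_pos hj']
          have := ((h2 ℓ hℓ ℓ' hℓ').2.2 (v := ⟨i - (ℓ - t), by omega⟩)
            (w := ⟨i - (ℓ - t) + s, by omega⟩)
            (by simp [Fin.ext_iff]; omega)).trans_le (cycleGraph_edist_le_sub s _ _ rfl)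
          have e1 : ℓ - t + (i - (ℓ - t)) = i := by omega
          have e2 : i - (ℓ - t) + s - t = i + s - ℓ := by omega
          have c1 : i - (ℓ - t) < t := by omega
          have c2 : ¬ i - (ℓ - t) + s < t := by omega
          simp only [if_pos c1, if_neg c2, e1, e2] at this
          exact_mod_cast this
    · rw [if_neg hi, if_neg (by omega : ¬ i + s < ℓ)]
      rw [(by omega : i + s - ℓ = i - ℓ + s)]
      exact ih hL' (i - ℓ) (by omega)


/-- Combining lemma: let `𝒞` be a set of integers, each at least `t`, and suppose `n` is a
nonnegative integer combination of elements of `𝒞`.  Given, for each `ℓ ∈ 𝒞`, a `t`-tone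
`k`-coloring `φ ℓ` of `C_ℓ` (vertex `i : Fin ℓ` gets label `φ ℓ i`, vertices in cyclic
order), such that for every ordered pair `(ℓ₁, ℓ₂) ∈ 𝒞 × 𝒞` the coloring of `C_{2t}` whose
first `t` vertices get the labels of the last `t` vertices of `C_{ℓ₁}` and whose last `t`
vertices get the labels of the first `t` vertices of `C_{ℓ₂}` is a `t`-tone `k`-coloring,
we conclude `τ_t(C_n) ≤ k`. -/
theorem tone_cycle_concatenation (t k n : ℕ) (ht : 0 < t) (hk : 0 < k) (hn : 0 < n)
    (𝒞 : Finset ℕ) (h𝒞 : ∀ ℓ ∈ 𝒞, t ≤ ℓ)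
    (c : ℕ → ℕ) (hcomb : n = ∑ ℓ ∈ 𝒞, c ℓ * ℓ)
    (φ : ℕ → ℕ → Finset ℕ)
    (h1 : ∀ ℓ ∈ 𝒞, IsTToneColoring (cycleGraph ℓ) t k (fun i : Fin ℓ => φ ℓ i.val))
    (h2 : ∀ ℓ₁ ∈ 𝒞, ∀ ℓ₂ ∈ 𝒞, IsTToneColoring (cycleGraph (2 * t)) t k
      (fun i : Fin (2 * t) =>
        if i.val < t then φ ℓ₁ (ℓ₁ - t + i.val) else φ ℓ₂ (i.val - t))) :
    toneChromaticNumber (cycleGraph n) t ≤ k := by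
  obtain ⟨L, hL, hsum⟩ : ∃ L : List ℕ, (∀ ℓ ∈ L, ℓ ∈ 𝒞) ∧ L.sum = n := by
    rw [hcomb]
    refine Finset.sum_induction _ (fun m => ∃ L : List ℕ, (∀ ℓ ∈ L, ℓ ∈ 𝒞) ∧ L.sum = m)
      ?_ ⟨[], by simp⟩ fun ℓ hℓ => ⟨List.replicate (c ℓ) ℓ, ?_, by simp⟩
    · rintro _ _ ⟨L, hL, rfl⟩ ⟨M, hM, rfl⟩
      refine ⟨L ++ M, fun ℓ hℓ => ?_, by simp⟩
      exact (List.mem_append.1 hℓ).elim (hL ℓ) (hM ℓ)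
    · intro x hx
      rwa [List.eq_of_mem_replicate hx]
  have hmod : ∀ i < 2 * n, blockWord φ (L ++ L) i = blockWord φ L (i % n) := by
    intro i hi
    rw [blockWord_append, hsum]
    split_ifs with h
    · rw [Nat.mod_eq_of_lt h]
    · rw [Nat.mod_eq_sub_mod (by omega), Nat.mod_eq_of_lt (by omega)]
  have harc : ∀ v w : Fin n, ∀ s : ℕ, 0 < s → s < n → s ≤ t → w.val = (v.val + s) % n →
      (blockWord φ L v ∩ blockWord φ L w).card < s := by
    intro v w s hs hsn hst hw
    have hv := v.isLt
    have := card_blockWord_inter_lt h𝒞 h1 h2 (L ++ L) (by simpa using hL) v s hs hst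
      (by simp [hsum]; omega)
    rwa [hmod _ (by omega), hmod _ (by omega), Nat.mod_eq_of_lt hv, ← hw] at this
  have hblock : ∀ v : Fin n, ∃ ℓ ∈ L, ∃ j < ℓ, blockWord φ L v = φ ℓ j := fun v =>
    exists_block_eq_blockWord φ L (by rw [hsum]; exact v.isLt)
  have hcard : ∀ v : Fin n, (blockWord φ L v).card = t := by
    intro v
    obtain ⟨ℓ, hℓ, j, hj, he⟩ := hblock v
    rw [he]
    exact (h1 ℓ (hL ℓ hℓ)).2.1 ⟨j, hj⟩
  refine Nat.sInf_le ⟨fun v : Fin n => blockWord φ L v, fun v => ?_, hcard, fun v w hvw => ?_⟩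
  · obtain ⟨ℓ, hℓ, j, hj, he⟩ := hblock v
    simp only [he]
    exact (h1 ℓ (hL ℓ hℓ)).1 ⟨j, hj⟩
  · by_contra! hle
    obtain ⟨p, hp⟩ := exists_walk_of_edist_ne_top (ne_top_of_le_ne_top (ENat.natCast_ne_top _) hle)
    rw [← hp, Nat.cast_le] at hle
    have hle_t : (blockWord φ L v ∩ blockWord φ L w).card ≤ t :=
      (Finset.card_le_card Finset.inter_subset_left).trans (hcard v).le
    obtain ⟨s, hs, hsn, hsp, h | h⟩ := cycleGraph_exists_arc hvw p
    · have := harc v w s hs hsn (by omega) h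
      omega
    · have := harc w v s hs hsn (by omega) h
      rw [Finset.inter_comm] at this
      omega
end

section
/- For all positive integers t and n, the t-tone chromatic number of the path on n vertices satisfies τ_t(P_n) = Σ_{i=0}^{n−1} max{0, t − C(i,2)}, where C(i,2) denotes the binomial coefficient i choose 2. -/
open SimpleGraph

/-- The number of colors used by a family of labels, counted label by label. -/
lemma card_biUnion_range_eq_sum_card_sdiff {α : Type*} [DecidableEq α] (F : ℕ → Finset α)
    (n : ℕ) :
    ((Finset.range n).biUnion F).card =
      ∑ i ∈ Finset.range n, (F i \ (Finset.range i).biUnion F).card := by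
  induction n with
  | zero => simp
  | succ n ih =>
    rw [Finset.sum_range_succ, ← ih, Finset.range_add_one, Finset.biUnion_insert,
      ← Finset.sdiff_union_self_eq_union, Finset.card_union_of_disjoint Finset.sdiff_disjoint,
      add_comm]

lemma sum_range_sub_succ_eq_choose (i : ℕ) :
    ∑ j ∈ Finset.range i, (i - j - 1) = i.choose 2 := by
  rw [Nat.choose_two_right, ← Finset.sum_range_id, ← Finset.sum_range_reflect]
  exact Finset.sum_congr rfl fun j hj => by
    rw [Finset.mem_range] at hj
    omega

lemma sum_le_card_biUnion_range {α : Type*} [DecidableEq α] (F : ℕ → Finset α) (t n : ℕ)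
    (hcard : ∀ i < n, (F i).card = t)
    (hinter : ∀ i < n, ∀ j < i, (F i ∩ F j).card < i - j) :
    ∑ i ∈ Finset.range n, (t - i.choose 2) ≤ ((Finset.range n).biUnion F).card := by
  rw [card_biUnion_range_eq_sum_card_sdiff]
  refine Finset.sum_le_sum fun i hi => ?_
  have hi := Finset.mem_range.1 hi
  have hold : (F i ∩ (Finset.range i).biUnion F).card ≤ i.choose 2 := by
    rw [Finset.inter_biUnion, ← sum_range_sub_succ_eq_choose]
    refine Finset.card_biUnion_le.trans (Finset.sum_le_sum fun j hj => ?_)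
    have := hinter i hi j (Finset.mem_range.1 hj)
    omega
  have := Finset.card_sdiff_add_card_inter (F i) ((Finset.range i).biUnion F)
  have := hcard i hi
  omega

lemma val_le_val_add_length {n : ℕ} {u v : Fin n} (p : (pathGraph n).Walk u v) :
    (v : ℕ) ≤ u + p.length := by
  induction p with
  | nil => simp
  | cons h p ih =>
    rw [pathGraph_adj] at h
    rw [Walk.length_cons]
    omega

lemma edist_pathGraph_add_le {n : ℕ} (d : ℕ) (u v : Fin n) (h : (v : ℕ) = u + d) :
    (pathGraph n).edist u v ≤ d := by
  induction d generalizing v with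
  | zero => simp [Fin.ext h]
  | succ d ih =>
    let w : Fin n := ⟨u + d, by omega⟩
    have hw : (pathGraph n).edist w v = 1 :=
      edist_eq_one_iff_adj.2 (pathGraph_adj.2 (Or.inl (by simp [w]; omega)))
    refine SimpleGraph.edist_triangle.trans (?_ : (pathGraph n).edist u w + _ ≤ _)
    rw [hw, Nat.cast_succ]
    gcongr
    exact ih w rfl

lemma edist_pathGraph {n : ℕ} {u v : Fin n} (h : u ≤ v) :
    (pathGraph n).edist u v = ((v - u : ℕ) : ℕ∞) := by
  have h : (u : ℕ) ≤ v := h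
  refine le_antisymm (edist_pathGraph_add_le _ u v (by omega)) ?_
  rw [edist_eq_sInf]
  refine le_sInf ?_
  rintro _ ⟨p, rfl⟩
  have := val_le_val_add_length p
  exact Nat.cast_le.2 (by omega : (v : ℕ) - u ≤ p.length)

lemma isTToneColoring_pathGraph_iff {n t k : ℕ} {f : Fin n → Finset ℕ} :
    IsTToneColoring (pathGraph n) t k f ↔
      (∀ v, f v ⊆ Finset.Icc 1 k) ∧ (∀ v, (f v).card = t) ∧
        ∀ v w : Fin n, w < v → (f v ∩ f w).card < (v - w : ℕ) := by
  refine and_congr Iff.rfl (and_congr Iff.rfl ⟨fun h v w hwv => ?_, fun h v w hne => ?_⟩)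
  · have := h hwv.ne
    rw [edist_pathGraph hwv.le, Finset.inter_comm] at this
    exact_mod_cast this
  · rcases hne.lt_or_gt with hlt | hlt
    · rw [edist_pathGraph hlt.le, Finset.inter_comm]
      exact_mod_cast h w v hlt
    · rw [SimpleGraph.edist_comm, edist_pathGraph hlt.le]
      exact_mod_cast h v w hlt

lemma IsTToneColoring.sum_le_of_pathGraph {n t k : ℕ} {f : Fin n → Finset ℕ}
    (hf : IsTToneColoring (pathGraph n) t k f) :
    ∑ i ∈ Finset.range n, (t - i.choose 2) ≤ k := by
  obtain ⟨hsub, hcard, hinter⟩ := isTToneColoring_pathGraph_iff.1 hf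
  let F : ℕ → Finset ℕ := fun i => if h : i < n then f ⟨i, h⟩ else ∅
  have hF (i : ℕ) (h : i < n) : F i = f ⟨i, h⟩ := dif_pos h
  have hle : ((Finset.range n).biUnion F).card ≤ (Finset.Icc 1 k).card := by
    refine Finset.card_le_card (Finset.biUnion_subset.2 fun i hi => ?_)
    rw [hF i (Finset.mem_range.1 hi)]
    exact hsub _
  rw [Nat.card_Icc, Nat.add_sub_cancel] at hle
  refine (sum_le_card_biUnion_range F t n (fun i hi => ?_) fun i hi j hj => ?_).trans hle
  · rw [hF i hi, hcard]
  · rw [hF i hi, hF j (hj.trans hi)]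
    exact hinter _ _ hj

/-- Labels from an arbitrary color type can be renamed to labels in `{1, …, k}`. -/
lemma exists_isTToneColoring_pathGraph {α : Type*} [DecidableEq α] (F : ℕ → Finset α)
    {t n k : ℕ} (hcard : ∀ i, (F i).card = t)
    (hinter : ∀ i j, j < i → (F i ∩ F j).card < i - j)
    (hk : ((Finset.range n).biUnion F).card ≤ k) :
    ∃ f, IsTToneColoring (pathGraph n) t k f := by
  set U := (Finset.range n).biUnion F with hU
  obtain ⟨g, hgU, hg⟩ : ∃ g : α → ℕ, (U : Set α) ⊆ g ⁻¹' (Finset.Icc 1 k : Finset ℕ) ∧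
      Set.InjOn g U := by
    refine U.finite_toSet.exists_injOn_of_encard_le ?_
    rw [Set.encard_coe_eq_coe_finsetCard, Set.encard_coe_eq_coe_finsetCard, Nat.card_Icc]
    exact_mod_cast hk
  have hFU (v : Fin n) : F v ⊆ U :=
    Finset.subset_biUnion_of_mem F (Finset.mem_range.2 v.2)
  refine ⟨fun v => (F v).image g, isTToneColoring_pathGraph_iff.2
    ⟨fun v => ?_, fun v => ?_, fun v w hwv => ?_⟩⟩
  · exact Finset.image_subset_iff.2 fun x hx => hgU (hFU v hx)
  · rw [Finset.card_image_of_injOn (hg.mono (hFU v)), hcard]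
  · rw [← Finset.image_inter_of_injOn]
    · exact Finset.card_image_le.trans_lt (hinter v w hwv)
    · exact hg.mono (Set.union_subset (hFU v) (hFU w))

/-- The slots of a vertex. A slot `(a, b)` with `a + b ≤ m` carries a color that returns after
`m + 1 - a` steps in slot `(b, a)`; a slot `(a, b)` with `a + b = m + 1` carries a color that
returns after `m + 1` steps in the same slot. -/
def toneSlots (m r : ℕ) : Finset (ℕ × ℕ) :=
  {p ∈ Finset.range (m + 1) ×ˢ Finset.range (m + 1) |
    1 ≤ p.1 ∧ 1 ≤ p.2 ∧ (p.1 + p.2 ≤ m ∨ p.1 + p.2 = m + 1 ∧ p.1 ≤ r)}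

lemma mem_toneSlots {m r a b : ℕ} : (a, b) ∈ toneSlots m r ↔
    1 ≤ a ∧ 1 ≤ b ∧ (a + b ≤ m ∨ a + b = m + 1 ∧ a ≤ r) := by
  simp only [toneSlots, Finset.mem_filter, Finset.mem_product, Finset.mem_range]
  omega

lemma card_toneSlots_eq_add {m r : ℕ} (hr : r ≤ m) :
    (toneSlots m r).card = (toneSlots m 0).card + r := by
  have hunion : toneSlots m r =
      toneSlots m 0 ∪ (Finset.Icc 1 r).image fun a => (a, m + 1 - a) := by
    ext ⟨a, b⟩
    simp only [Finset.mem_union, mem_toneSlots, Finset.mem_image, Finset.mem_Icc, Prod.mk.injEq]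
    constructor
    · intro h
      by_cases hab : a + b ≤ m
      · exact Or.inl (by omega)
      · exact Or.inr ⟨a, by omega, rfl, by omega⟩
    · rintro (h | ⟨c, h, rfl, rfl⟩) <;> omega
  have hdisj : Disjoint (toneSlots m 0) ((Finset.Icc 1 r).image fun a => (a, m + 1 - a)) := by
    refine Finset.disjoint_left.2 ?_
    rintro ⟨a, b⟩
    simp only [mem_toneSlots, Finset.mem_image, Finset.mem_Icc, Prod.mk.injEq]
    rintro h ⟨c, h', rfl, rfl⟩
    omega
  rw [hunion, Finset.card_union_of_disjoint hdisj, Finset.card_image_of_injective, Nat.card_Icc,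
    Nat.add_sub_cancel]
  exact fun a b h => congrArg Prod.fst h

lemma card_toneSlots_zero (m : ℕ) : (toneSlots m 0).card = m.choose 2 := by
  induction m with
  | zero => rfl
  | succ m ih =>
    have : toneSlots (m + 1) 0 = toneSlots m m := by
      ext ⟨a, b⟩
      simp only [mem_toneSlots]
      omega
    rw [this, card_toneSlots_eq_add le_rfl, ih, Nat.choose_succ_succ' m 1, Nat.choose_one_right,
      add_comm]

lemma card_toneSlots {m r : ℕ} (hr : r ≤ m) : (toneSlots m r).card = m.choose 2 + r := by
  rw [card_toneSlots_eq_add hr, card_toneSlots_zero]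

lemma exists_eq_choose_two_add (t : ℕ) : ∃ m r, r < m ∧ t = m.choose 2 + r := by
  induction t with
  | zero => exact ⟨1, 0, by simp⟩
  | succ t ih =>
    obtain ⟨m, r, hr, rfl⟩ := ih
    by_cases h : r + 1 < m
    · exact ⟨m, r + 1, h, rfl⟩
    · refine ⟨m + 1, 0, by omega, ?_⟩
      rw [Nat.choose_succ_succ' m 1, Nat.choose_one_right]
      change m.choose 2 + r + 1 = m + m.choose 2 + 0
      omega

/-- The number of steps after which a color returns to the same slot. -/
def tonePeriod (m : ℕ) (p : ℕ × ℕ) : ℕ := 2 * m + 2 - (p.1 + p.2)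

lemma card_toneSlots_dvd_le {m r d q : ℕ} (hr : r < m) (hd : 2 * m < d) (hq : q = d / (m + 1)) :
    {p ∈ toneSlots m r | tonePeriod m p ∣ d}.card ≤ (q - 1) * (m - 1) := by
  have hbox : (Finset.Icc 2 q ×ˢ Finset.Icc 1 (m - 1)).card = (q - 1) * (m - 1) := by
    rw [Finset.card_product, Nat.card_Icc, Nat.card_Icc]
    congr 1
  rw [← hbox]
  refine Finset.card_le_card_of_injOn (fun p => (d / tonePeriod m p, p.1)) ?_ ?_
  · rintro ⟨a, b⟩ h
    simp only [Finset.coe_filter, Set.mem_ofPred_eq, mem_toneSlots] at h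
    obtain ⟨hab, k, hk⟩ := h
    have hP : m + 1 ≤ tonePeriod m (a, b) ∧ tonePeriod m (a, b) ≤ 2 * m := by
      simp only [tonePeriod]; omega
    have hdiv : d / tonePeriod m (a, b) = k := by
      rw [hk, Nat.mul_div_cancel_left _ (by omega)]
    simp only [Finset.coe_product, Set.mem_prod, Finset.coe_Icc, Set.mem_Icc, hdiv]
    refine ⟨⟨?_, ?_⟩, by omega⟩
    · by_contra hlt
      have : k ≤ 1 := by omega
      nlinarith
    · rw [hq, Nat.le_div_iff_mul_le (by omega)]
      nlinarith
  · rintro ⟨a, b⟩ h ⟨a', b'⟩ h' heq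
    simp only [Finset.coe_filter, Set.mem_ofPred_eq, mem_toneSlots] at h h'
    simp only [Prod.mk.injEq] at heq ⊢
    obtain ⟨heq, rfl⟩ := heq
    have hPP : tonePeriod m (a, b) = tonePeriod m (a, b') := by
      have h1 := Nat.div_mul_cancel h.2
      have h2 := Nat.div_mul_cancel h'.2
      rw [← heq] at h2
      refine Nat.eq_of_mul_eq_mul_left (Nat.pos_of_ne_zero fun h0 => ?_) (h1.trans h2.symm)
      rw [h0] at h1
      omega
    simp only [tonePeriod] at hPP
    omega

lemma card_toneSlots_mod_le {m r d : ℕ} (hd : m < d) :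
    {p ∈ toneSlots m r | p.1 + p.2 ≤ m ∧ d % tonePeriod m p = m + 1 - p.1}.card ≤
      (Finset.Icc (max 2 (2 * m + 3 - d)) m).card := by
  refine Finset.card_le_card_of_injOn (fun p => p.1 + p.2) ?_ ?_
  · rintro ⟨a, b⟩ h
    simp only [Finset.coe_filter, Set.mem_ofPred_eq, mem_toneSlots] at h
    obtain ⟨hab, hm, hmod⟩ := h
    have hP : tonePeriod m (a, b) < d := by
      by_contra hlt
      rcases (not_lt.1 hlt).lt_or_eq with hlt | heq
      · rw [Nat.mod_eq_of_lt hlt] at hmod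
        omega
      · rw [← heq, Nat.mod_self] at hmod
        omega
    simp only [tonePeriod] at hP
    simp only [Finset.coe_Icc, Set.mem_Icc]
    omega
  · rintro ⟨a, b⟩ h ⟨a', b'⟩ h' heq
    simp only [Finset.coe_filter, Set.mem_ofPred_eq, mem_toneSlots] at h h'
    simp only [tonePeriod] at h h' heq
    rw [heq] at h
    simp only [Prod.mk.injEq]
    omega

lemma card_toneSlots_return_lt {m r d : ℕ} (hr : r < m) (hd : 0 < d) :
    {p ∈ toneSlots m r | tonePeriod m p ∣ d ∨
      p.1 + p.2 ≤ m ∧ d % tonePeriod m p = m + 1 - p.1}.card < d := by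
  rcases le_or_gt d m with hdm | hdm
  · suffices h : {p ∈ toneSlots m r | tonePeriod m p ∣ d ∨
        p.1 + p.2 ≤ m ∧ d % tonePeriod m p = m + 1 - p.1}.card ≤ (Finset.Icc 1 (d - 1)).card by
      rw [Nat.card_Icc] at h
      omega
    have key : ∀ a b, (a, b) ∈ ({p ∈ toneSlots m r | tonePeriod m p ∣ d ∨
        p.1 + p.2 ≤ m ∧ d % tonePeriod m p = m + 1 - p.1} : Finset (ℕ × ℕ)) →
        1 ≤ b ∧ a + b ≤ m ∧ d + a = m + 1 := by
      intro a b h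
      simp only [Finset.mem_filter, mem_toneSlots] at h
      have hP : d < tonePeriod m (a, b) := by
        simp only [tonePeriod]; omega
      rw [Nat.mod_eq_of_lt hP] at h
      have := Nat.not_dvd_of_pos_of_lt hd hP
      have := h.2.resolve_left this
      omega
    refine Finset.card_le_card_of_injOn Prod.snd ?_ ?_
    · rintro ⟨a, b⟩ h
      have := key a b h
      simp only [Finset.coe_Icc, Set.mem_Icc]
      omega
    · rintro ⟨a, b⟩ h ⟨a', b'⟩ h' heq
      have := key a b h
      have := key a' b' h'
      simp only [Prod.mk.injEq] at heq ⊢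
      omega
  rw [Finset.filter_or]
  refine (Finset.card_union_le _ _).trans_lt ?_
  have hmod := card_toneSlots_mod_le (r := r) hdm
  rw [Nat.card_Icc] at hmod
  rcases le_or_gt d (2 * m) with hd2 | hd2
  · have hdvd : {p ∈ toneSlots m r | tonePeriod m p ∣ d}.card ≤
        (Finset.Icc 1 (min (m - 1) (2 * m + 1 - d))).card := by
      have key : ∀ a b, (a, b) ∈ ({p ∈ toneSlots m r | tonePeriod m p ∣ d} : Finset (ℕ × ℕ)) →
          1 ≤ a ∧ a ≤ m - 1 ∧ 1 ≤ b ∧ d + a + b = 2 * m + 2 := by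
        intro a b h
        simp only [Finset.mem_filter, mem_toneSlots] at h
        obtain ⟨hab, k, hk⟩ := h
        have hP : m + 1 ≤ tonePeriod m (a, b) := by
          simp only [tonePeriod]; omega
        have hk1 : k = 1 := by
          by_contra hne
          rcases Nat.lt_or_gt_of_ne hne with h | h
          · obtain rfl : k = 0 := by omega
            omega
          · nlinarith
        rw [hk1, mul_one, tonePeriod] at hk
        simp only at hk
        omega
      refine Finset.card_le_card_of_injOn Prod.fst ?_ ?_
      · rintro ⟨a, b⟩ h
        have := key a b h
        simp only [Finset.coe_Icc, Set.mem_Icc]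
        omega
      · rintro ⟨a, b⟩ h ⟨a', b'⟩ h' heq
        have := key a b h
        have := key a' b' h'
        simp only [Prod.mk.injEq] at heq ⊢
        omega
    rw [Nat.card_Icc] at hdvd
    omega
  · have hdvd := card_toneSlots_dvd_le hr hd2 rfl
    have hq : d / (m + 1) * (m + 1) ≤ d := Nat.div_mul_le_self _ _
    have hq1 : 1 ≤ d / (m + 1) := (Nat.le_div_iff_mul_le (by omega)).2 (by omega)
    obtain ⟨q, hq'⟩ := Nat.exists_eq_add_of_le' hq1
    obtain ⟨l, rfl⟩ := Nat.exists_eq_add_of_le' (show 1 ≤ m by omega)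
    rw [hq'] at hdvd hq
    simp only [Nat.add_sub_cancel] at hdvd
    have : l + 1 + 1 - max 2 (2 * (l + 1) + 3 - d) ≤ l := by omega
    nlinarith

/-- The color carried by slot `p` of vertex `i`, given as the set of all pairs of a vertex and a
slot carrying it. -/
def toneColor (m : ℕ) (i : ℤ) (p : ℕ × ℕ) : Set (ℤ × ℕ × ℕ) :=
  {x | x.2 = p ∧ (tonePeriod m p : ℤ) ∣ x.1 - i ∨
    p.1 + p.2 ≤ m ∧ x.2 = p.swap ∧ (tonePeriod m p : ℤ) ∣ x.1 - i - (m + 1 - p.1)}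

lemma mem_toneColor {m : ℕ} {i j : ℤ} {p q : ℕ × ℕ} : (j, q) ∈ toneColor m i p ↔
    q = p ∧ (tonePeriod m p : ℤ) ∣ j - i ∨
      p.1 + p.2 ≤ m ∧ q = p.swap ∧ (tonePeriod m p : ℤ) ∣ j - i - (m + 1 - p.1) :=
  Iff.rfl

lemma self_mem_toneColor (m : ℕ) (i : ℤ) (p : ℕ × ℕ) : (i, p) ∈ toneColor m i p :=
  mem_toneColor.2 (Or.inl ⟨rfl, by simp⟩)

lemma eq_or_return_of_toneColor_eq {m r i j : ℕ} {p q : ℕ × ℕ} (hp : p ∈ toneSlots m r)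
    (hji : j ≤ i) (h : toneColor m j p = toneColor m i q) :
    q = p ∧ tonePeriod m p ∣ i - j ∨
      p.1 + p.2 ≤ m ∧ (i - j) % tonePeriod m p = m + 1 - p.1 := by
  obtain ⟨a, b⟩ := p
  rw [mem_toneSlots] at hp
  have hq := self_mem_toneColor m i q
  rw [← h, mem_toneColor, ← Nat.cast_sub hji] at hq
  refine hq.imp (And.imp_right Int.natCast_dvd_natCast.1) fun ⟨hab, _, hdvd⟩ => ⟨hab, ?_⟩
  simp only at hab hdvd ⊢
  have hmod : m + 1 - a ≡ i - j [MOD tonePeriod m (a, b)] := by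
    rw [Nat.modEq_iff_dvd, Nat.cast_sub (show a ≤ m + 1 by omega)]
    exact_mod_cast hdvd
  rw [← hmod, Nat.mod_eq_of_lt]
  simp only [tonePeriod]
  omega

lemma toneColor_injOn (m r i : ℕ) : Set.InjOn (toneColor m i) (toneSlots m r) := by
  rintro ⟨a, b⟩ hp q - h
  rcases eq_or_return_of_toneColor_eq hp le_rfl h with ⟨rfl, -⟩ | ⟨hab, hmod⟩
  · rfl
  · rw [Nat.sub_self, Nat.zero_mod] at hmod
    simp only at hab hmod
    omega

lemma toneColor_swap {m a b : ℕ} (hab : a + b ≤ m) (i : ℤ) :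
    toneColor m (i + (m + 1 - b)) (a, b) = toneColor m i (b, a) := by
  have hP : ((tonePeriod m (a, b) : ℕ) : ℤ) = 2 * m + 2 - (a + b) := by
    simp only [tonePeriod]
    omega
  have hP' : tonePeriod m (b, a) = tonePeriod m (a, b) := by
    simp only [tonePeriod, add_comm b a]
  ext ⟨x, q⟩
  have hshift : (tonePeriod m (a, b) : ℤ) ∣ x - (i + (m + 1 - b)) - (m + 1 - a) ↔
      (tonePeriod m (a, b) : ℤ) ∣ x - i := by
    rw [← dvd_sub_self_right (b := x - i), hP]
    ring_nf
  simp only [mem_toneColor, Prod.swap_prod_mk, hP', hshift, add_comm b a,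
    show x - i - (m + 1 - b) = x - (i + (m + 1 - b)) by ring]
  tauto

lemma toneColor_add_succ {m a b : ℕ} (hab : a + b = m + 1) (i : ℤ) :
    toneColor m (i + (m + 1)) (a, b) = toneColor m i (a, b) := by
  have hP : ((tonePeriod m (a, b) : ℕ) : ℤ) = m + 1 := by
    simp only [tonePeriod]
    omega
  ext ⟨x, q⟩
  have : ¬ a + b ≤ m := by omega
  simp only [mem_toneColor, this, false_and, or_false, hP, ← sub_sub x i, dvd_sub_self_right]

open Classical in
/-- The label of vertex `i` in the optimal coloring. -/
noncomputable def toneLabel (m r i : ℕ) : Finset (Set (ℤ × ℕ × ℕ)) :=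
  (toneSlots m r).image (toneColor m i)

lemma card_toneLabel {m r : ℕ} (hr : r < m) (i : ℕ) :
    (toneLabel m r i).card = m.choose 2 + r := by
  rw [toneLabel, Finset.card_image_of_injOn (toneColor_injOn m r i), card_toneSlots hr.le]

lemma toneColor_mem_toneLabel {m r j : ℕ} {p : ℕ × ℕ} (hp : p ∈ toneSlots m r) :
    toneColor m j p ∈ toneLabel m r j :=
  Finset.mem_image_of_mem _ hp

open Classical in
lemma card_toneLabel_inter_lt {m r i j : ℕ} (hr : r < m) (hji : j < i) :
    (toneLabel m r i ∩ toneLabel m r j).card < i - j := by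
  refine lt_of_le_of_lt ?_ (card_toneSlots_return_lt hr (Nat.sub_pos_of_lt hji))
  refine (Finset.card_le_card fun c hc => ?_).trans
    (Finset.card_image_le (f := toneColor m j))
  obtain ⟨hci, hcj⟩ := Finset.mem_inter.1 hc
  obtain ⟨q, hq, rfl⟩ := Finset.mem_image.1 hci
  obtain ⟨p, hp, hpq⟩ := Finset.mem_image.1 hcj
  refine Finset.mem_image.2 ⟨p, Finset.mem_filter.2 ⟨hp, ?_⟩, hpq⟩
  exact (eq_or_return_of_toneColor_eq hp hji.le hpq).imp_left And.right

open Classical in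
lemma toneColor_mem_biUnion {m r i a b : ℕ} (h : (a, b) ∈ toneSlots m r)
    (hi : m + 1 - b ≤ i ∧ a + b ≤ m ∨ m + 1 ≤ i) :
    toneColor m i (a, b) ∈ (Finset.range i).biUnion (toneLabel m r) := by
  rw [Finset.mem_biUnion]
  have h' := mem_toneSlots.1 h
  by_cases hab : a + b ≤ m
  · have hcast : (i : ℤ) = (i - (m + 1 - b) : ℕ) + (m + 1 - b) := by omega
    refine ⟨i - (m + 1 - b), Finset.mem_range.2 (by omega), ?_⟩
    rw [hcast, toneColor_swap hab]
    exact toneColor_mem_toneLabel (mem_toneSlots.2 (by omega))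
  · have hcast : (i : ℤ) = (i - (m + 1) : ℕ) + (m + 1) := by omega
    refine ⟨i - (m + 1), Finset.mem_range.2 (by omega), ?_⟩
    rw [hcast, toneColor_add_succ (by omega)]
    exact toneColor_mem_toneLabel h

open Classical in
lemma card_toneLabel_sdiff_le {m r : ℕ} (hr : r < m) (i : ℕ) :
    (toneLabel m r i \ (Finset.range i).biUnion (toneLabel m r)).card ≤
      m.choose 2 + r - i.choose 2 := by
  rcases le_or_gt i m with him | him
  · rw [← card_toneLabel hr i, ← card_toneSlots_zero i]
    let old := ((toneSlots i 0).image fun p => (p.1, p.2 + (m - i))).image (toneColor m i)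
    have hsub : (toneSlots i 0).image (fun p => (p.1, p.2 + (m - i))) ⊆ toneSlots m r := by
      refine Finset.image_subset_iff.2 ?_
      rintro ⟨a, b⟩ h
      rw [mem_toneSlots] at h ⊢
      omega
    have hcard : old.card = (toneSlots i 0).card := by
      rw [Finset.card_image_of_injOn ((toneColor_injOn m r i).mono hsub),
        Finset.card_image_of_injective]
      rintro ⟨a, b⟩ ⟨a', b'⟩ h
      simp only [Prod.mk.injEq] at h ⊢
      omega
    have hold : old ⊆ toneLabel m r i := Finset.image_subset_image hsub
    rw [← hcard, ← Finset.card_sdiff_of_subset hold]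
    refine Finset.card_le_card (Finset.sdiff_subset_sdiff subset_rfl ?_)
    refine Finset.image_subset_iff.2 (Finset.forall_mem_image.2 ?_)
    rintro ⟨a, b⟩ h
    refine toneColor_mem_biUnion (hsub (Finset.mem_image_of_mem _ h)) (Or.inl ?_)
    rw [mem_toneSlots] at h
    omega
  · rw [Finset.sdiff_eq_empty_iff_subset.2, Finset.card_empty]
    · exact Nat.zero_le _
    · exact Finset.image_subset_iff.2 fun p hp => toneColor_mem_biUnion hp (Or.inr him)

/-- `τ_t(P_n) = Σ_{i=0}^{n-1} max {0, t - C(i,2)}` for all positive integers `t` and `n`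
(here `t - C(i,2)` is truncated ℕ-subtraction, which equals `max {0, t - C(i,2)}`). -/
theorem tone_path (t n : ℕ) (ht : 0 < t) (hn : 0 < n) :
    toneChromaticNumber (pathGraph n) t = ∑ i ∈ Finset.range n, (t - i.choose 2) := by
  obtain ⟨m, r, hr, rfl⟩ := exists_eq_choose_two_add t
  have hm : 2 ≤ m := by
    by_contra hlt
    rw [Nat.choose_eq_zero_of_lt (by omega)] at ht
    omega
  classical
  refine IsLeast.csInf_eq ⟨?_, fun k ⟨f, hf⟩ => hf.sum_le_of_pathGraph⟩
  refine exists_isTToneColoring_pathGraph (toneLabel m r) (card_toneLabel hr)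
    (fun i j => card_toneLabel_inter_lt hr) ?_
  rw [card_biUnion_range_eq_sum_card_sdiff]
  exact Finset.sum_le_sum fun i _ => card_toneLabel_sdiff_le hr i
end
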